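/- Let G be an infinite countable amenable group and let g ∈ G with g ≠ e. Then there exists a two-element alphabet Λ and a nonempty closed shift-invariant set X ⊆ Λ^G with topological entropy zero such that gy ≠ y for every y ∈ X. -/

import Mathlib

open scoped Pointwise symmDiff Classical
open Filter

namespace AmenableTilings

variable {G : Type*}

/-- The left translate `gF` of a finite set `F`. -/
noncomputable def lMul [Group G] (g : G) (F : Finset G) : Finset G := F.image (fun h => g * h)

/-- The right translate `Fg` of a finite set `F`. -/
noncomputable def rMul [Group G] (F : Finset G) (g : G) : Finset G := F.image (fun h => h * g)

/-- A Følner sequence: a sequence of finite nonempty sets with `|gFₙ Δ Fₙ|/|Fₙ| → 0`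
for every `g`. -/
def IsFolnerSeq [Group G] (F : ℕ → Finset G) : Prop :=
  (∀ n, (F n).Nonempty) ∧
  ∀ g : G, Tendsto (fun n => (((lMul g (F n)) ∆ (F n)).card : ℝ) / ((F n).card : ℝ))
    atTop (nhds 0)

/-- A group is amenable if it admits a Følner sequence. -/
def IsAmenable (G : Type*) [Group G] : Prop := ∃ F : ℕ → Finset G, IsFolnerSeq F

/-- `(K,ε)`-invariance: `|KT Δ T| < ε|T|`, where `KT = {gh : g ∈ K, h ∈ T}`. -/
def KInvariant [Group G] (K T : Finset G) (ε : ℝ) : Prop :=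
  (((K * T) ∆ T).card : ℝ) < ε * (T.card : ℝ)

/-- `|S ∩ Fg|`. -/
noncomputable def interCard [Group G] (S : Set G) (F : Finset G) (g : G) : ℕ :=
  ((rMul F g).filter (fun h => h ∈ S)).card

/-- `D̲_F(S) = inf_g |S ∩ Fg| / |F|`. -/
noncomputable def lowerD [Group G] (S : Set G) (F : Finset G) : ℝ :=
  ⨅ g : G, (interCard S F g : ℝ) / (F.card : ℝ)

/-- `D̄_F(S) = sup_g |S ∩ Fg| / |F|`. -/
noncomputable def upperD [Group G] (S : Set G) (F : Finset G) : ℝ :=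
  ⨆ g : G, (interCard S F g : ℝ) / (F.card : ℝ)

/-- Lower Banach density: `sup { D̲_F(S) : F finite nonempty }`. -/
noncomputable def lowerBD [Group G] (S : Set G) : ℝ :=
  sSup {r : ℝ | ∃ F : Finset G, F.Nonempty ∧ r = lowerD S F}

/-- Upper Banach density: `inf { D̄_F(S) : F finite nonempty }`. -/
noncomputable def upperBD [Group G] (S : Set G) : ℝ :=
  sInf {r : ℝ | ∃ F : Finset G, F.Nonempty ∧ r = upperD S F}

/-- The shift action of `G` on `Λ^G`: `(gx)(h) = x(hg)`. -/
def shift [Group G] {Λ : Type*} (g : G) (x : G → Λ) : G → Λ := fun h => x (h * g)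

/-- The orbit closure of `x ∈ Λ^G` under the shift action (with `Λ` discrete and
`Λ^G` carrying the product topology). -/
noncomputable def orbitClosure [Group G] {Λ : Type*} (x : G → Λ) : Set (G → Λ) :=
  @closure _ (@Pi.topologicalSpace G (fun _ => Λ) (fun _ => ⊥)) {y | ∃ g : G, y = shift g x}

/-- `N_X(F)`: the number of blocks with domain `F` occurring in `X`. -/
noncomputable def complexity [Group G] {Λ : Type*} (X : Set (G → Λ)) (F : Finset G) : ℕ :=
  Set.ncard ((fun x (f : {a // a ∈ F}) => x f.1) '' X)

/-- Topological entropy of a symbolic system: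
`inf { (1/|F|) log₂ N_X(F) : F finite nonempty }`. -/
noncomputable def entropyOf [Group G] {Λ : Type*} (X : Set (G → Λ)) : ℝ :=
  sInf {r : ℝ | ∃ F : Finset G, F.Nonempty ∧
    r = Real.logb 2 (complexity X F) / (F.card : ℝ)}

/-- The entropy of (the shift-orbit closure of) a symbolic element. -/
noncomputable def pointEntropy [Group G] {Λ : Type*} (x : G → Λ) : ℝ :=
  entropyOf (orbitClosure x)

/-- A quasitiling of `G`: finitely many finite shapes containing the identity,
with pairwise disjoint center sets, such that the map `(S,c) ↦ Sc` is injective. -/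
structure Quasitiling (G : Type*) [Group G] where
  shapes : Finset (Finset G)
  centers : Finset G → Set G
  one_mem : ∀ S ∈ shapes, (1 : G) ∈ S
  centers_empty : ∀ S, S ∉ shapes → centers S = ∅
  centers_disjoint : ∀ S ∈ shapes, ∀ S' ∈ shapes, S ≠ S' → Disjoint (centers S) (centers S')
  tiles_inj : ∀ S ∈ shapes, ∀ S' ∈ shapes, ∀ c ∈ centers S, ∀ c' ∈ centers S',
    rMul S c = rMul S' c' → S = S' ∧ c = c'

namespace Quasitiling

variable [Group G]

/-- `(S,c)` is a tile of the quasitiling. -/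
def IsTile (𝒯 : Quasitiling G) (S : Finset G) (c : G) : Prop :=
  S ∈ 𝒯.shapes ∧ c ∈ 𝒯.centers S

/-- The union of all tiles of the quasitiling. -/
def union (𝒯 : Quasitiling G) : Set G :=
  ⋃ S ∈ 𝒯.shapes, ⋃ c ∈ 𝒯.centers S, (↑(rMul S c) : Set G)

/-- `f` witnesses `ε`-disjointness: it assigns to each tile a `(1-ε)`-subset, and the
assigned subsets of distinct tiles are pairwise disjoint. -/
def EpsDisjointWith (𝒯 : Quasitiling G) (ε : ℝ) (f : Finset G → G → Finset G) : Prop :=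
  (∀ S c, 𝒯.IsTile S c →
    f S c ⊆ rMul S c ∧ (1 - ε) * (S.card : ℝ) ≤ ((f S c).card : ℝ)) ∧
  (∀ S c S' c', 𝒯.IsTile S c → 𝒯.IsTile S' c' → (S, c) ≠ (S', c') →
    Disjoint (f S c) (f S' c'))

/-- `ε`-disjointness of a quasitiling. -/
def EpsDisjoint (𝒯 : Quasitiling G) (ε : ℝ) : Prop := ∃ f, 𝒯.EpsDisjointWith ε f

/-- The tiles are pairwise disjoint. -/
def TilesDisjoint (𝒯 : Quasitiling G) : Prop :=
  ∀ S c S' c', 𝒯.IsTile S c → 𝒯.IsTile S' c' → (S, c) ≠ (S', c') →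
    Disjoint (rMul S c) (rMul S' c')

/-- `α`-covering: the union of the tiles has lower Banach density at least `α`. -/
def Covering (𝒯 : Quasitiling G) (α : ℝ) : Prop := α ≤ lowerBD 𝒯.union

/-- An exact tiling: the tiles form a partition of `G`. -/
def IsExactTiling (𝒯 : Quasitiling G) : Prop := 𝒯.TilesDisjoint ∧ 𝒯.union = Set.univ

/-- The symbolic representation `x_𝒯` of a quasitiling, over the alphabet
`𝒮(𝒯) ∪ {0}` (encoded as `Option (Finset G)`, with `none` playing the role of `0`):
`x_𝒯(g) = S` iff `g ∈ C(S)`. -/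
noncomputable def symb (𝒯 : Quasitiling G) : G → Option (Finset G) :=
  fun g => if h : ∃ S, S ∈ 𝒯.shapes ∧ g ∈ 𝒯.centers S then some h.choose else none

/-- The entropy of a quasitiling: the topological entropy of the shift-orbit closure of
its symbolic representation. -/
noncomputable def entropy (𝒯 : Quasitiling G) : ℝ := pointEntropy 𝒯.symb

end Quasitiling

/-- `𝒯'` is congruent with `𝒯` (each tile of `𝒯'` is a union of tiles of `𝒯`). -/
def Congruent [Group G] (𝒯 𝒯' : Quasitiling G) : Prop :=
  ∀ S c, 𝒯'.IsTile S c → ∃ P : Set (Finset G × G),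
    (∀ p ∈ P, 𝒯.IsTile p.1 p.2) ∧
    (↑(rMul S c) : Set G) = ⋃ p ∈ P, (↑(rMul p.1 p.2) : Set G)

/-- The union over all tiles `(S,c)` of the assigned subsets `f S c`. -/
def subUnion [Group G] (𝒯 : Quasitiling G) (f : Finset G → G → Finset G) : Set G :=
  ⋃ S ∈ 𝒯.shapes, ⋃ c ∈ 𝒯.centers S, (↑(f S c) : Set G)

end AmenableTilings

namespace AmenableTilings

section Colorings

variable {G : Type*} [Group G]

/-- A coloring giving distinct colors to `a ≠ b` whenever the translates `Fa` and `Fb` meet. -/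
def IsProperColoring (F : Finset G) {M : ℕ} (χ : G → Fin M) : Prop :=
  ∀ a b, a ≠ b → b * a⁻¹ ∈ F⁻¹ * F → χ a ≠ χ b

/-- The region covered after the first `j` colors have been processed: the translate `Fc` is
selected, when the color of `c` is processed, if at least `θ|F|` of its elements are new. -/
noncomputable def covered (F : Finset G) (θ : ℝ) {M : ℕ} (χ : G → Fin M) : ℕ → Set G
  | 0 => ∅
  | j + 1 => covered F θ χ j ∪ {a | ∃ c, (χ c : ℕ) = j ∧ a * c⁻¹ ∈ F ∧
      θ * F.card ≤ ((F.filter (fun f => f * c ∉ covered F θ χ j)).card : ℝ)}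

/-- The translate `Fc` is selected. -/
def IsCenter (F : Finset G) (θ : ℝ) {M : ℕ} (χ : G → Fin M) (c : G) : Prop :=
  θ * F.card ≤ ((F.filter (fun f => f * c ∉ covered F θ χ (χ c))).card : ℝ)

/-- `a` belongs to the new part of the selected translate `Fc`. -/
def Owns (F : Finset G) (θ : ℝ) {M : ℕ} (χ : G → Fin M) (a c : G) : Prop :=
  IsCenter F θ χ c ∧ a * c⁻¹ ∈ F ∧ a ∉ covered F θ χ (χ c)

variable {F : Finset G} {θ : ℝ} {M : ℕ} {χ : G → Fin M}

lemma mem_covered_succ {j : ℕ} {a : G} : a ∈ covered F θ χ (j + 1) ↔ a ∈ covered F θ χ j ∨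
    ∃ c, (χ c : ℕ) = j ∧ a * c⁻¹ ∈ F ∧ IsCenter F θ χ c := by
  simp only [covered, Set.mem_union, Set.mem_ofPred_eq]
  refine or_congr_right (exists_congr fun c => and_congr_right fun h => ?_)
  subst h
  rfl

lemma mem_covered_iff {j : ℕ} {a : G} : a ∈ covered F θ χ j ↔
    ∃ c, (χ c : ℕ) < j ∧ a * c⁻¹ ∈ F ∧ IsCenter F θ χ c := by
  induction j with
  | zero => simp [covered]
  | succ j ih =>
    rw [mem_covered_succ, ih]
    constructor
    · rintro (⟨c, h, h'⟩ | ⟨c, h, h'⟩)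
      · exact ⟨c, by omega, h'⟩
      · exact ⟨c, by omega, h'⟩
    · rintro ⟨c, h, h'⟩
      rcases Nat.lt_succ_iff_lt_or_eq.1 h with h | h
      · exact Or.inl ⟨c, h, h'⟩
      · exact Or.inr ⟨c, h, h'⟩

lemma Owns.unique (hχ : IsProperColoring F χ) {a c c' : G} (h : Owns F θ χ a c)
    (h' : Owns F θ χ a c') : c = c' := by
  by_contra hne
  have hcol : χ c ≠ χ c' := hχ c c' hne (Finset.mem_mul.2
    ⟨(a * c'⁻¹)⁻¹, Finset.inv_mem_inv h'.2.1, a * c⁻¹, h.2.1, by group⟩)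
  rcases lt_or_gt_of_ne hcol with hlt | hlt
  · exact h'.2.2 (mem_covered_iff.2 ⟨c, hlt, h.2.1, h.1⟩)
  · exact h.2.2 (mem_covered_iff.2 ⟨c', hlt, h'.2.1, h'.1⟩)

lemma exists_owns {j : ℕ} {a : G} (h : a ∈ covered F θ χ j) : ∃ c, Owns F θ χ a c := by
  induction j with
  | zero => simp [covered] at h
  | succ j ih =>
    by_cases hj : a ∈ covered F θ χ j
    · exact ih hj
    · obtain h | ⟨c, hc, hF, hC⟩ := mem_covered_succ.1 h
      · exact absurd h hj
      · exact ⟨c, hC, hF, by rwa [hc]⟩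

lemma card_filter_notMem_covered_le (hθ : 0 ≤ θ) (k : G) :
    ((F.filter (fun f => f * k ∉ covered F θ χ M)).card : ℝ) ≤ θ * F.card := by
  by_cases hk : IsCenter F θ χ k
  · rw [Finset.filter_false_of_mem]
    · simp; positivity
    · intro f hf
      rw [not_not]
      exact mem_covered_iff.2 ⟨k, (χ k).2, by simpa using hf, hk⟩
  · refine le_trans ?_ (not_le.1 hk).le
    refine Nat.cast_le.2
      (Finset.card_le_card (Finset.monotone_filter_right F fun f _ hf h => hf ?_))
    obtain ⟨c, hc, hc'⟩ := mem_covered_iff.1 h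
    exact mem_covered_iff.2 ⟨c, hc.trans (χ k).2, hc'⟩

lemma covered_local (F : Finset G) (θ : ℝ) (M j : ℕ) : ∃ Q : Finset G, ∀ a : G,
    ∀ χ χ' : G → Fin M, (∀ q ∈ Q, χ (q * a) = χ' (q * a)) →
      (a ∈ covered F θ χ j ↔ a ∈ covered F θ χ' j) := by
  induction j with
  | zero => exact ⟨∅, by simp [covered]⟩
  | succ j ih =>
    obtain ⟨Q, hQ⟩ := ih
    refine ⟨Q ∪ F⁻¹ ∪ Q * F * F⁻¹, fun a χ χ' h => ?_⟩
    simp only [covered, Set.mem_union, Set.mem_ofPred_eq]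
    refine or_congr (hQ a χ χ' fun q hq => h q (by simp [hq])) (exists_congr fun c => ?_)
    by_cases hc : a * c⁻¹ ∈ F
    · have hcF : c * a⁻¹ ∈ F⁻¹ := by simpa using hc
      have h1 : χ c = χ' c := by
        have := h (c * a⁻¹) (by simp only [Finset.mem_union]; tauto)
        simpa using this
      have h2 : F.filter (fun f => f * c ∉ covered F θ χ j) =
          F.filter (fun f => f * c ∉ covered F θ χ' j) := by
        refine Finset.filter_congr fun f hf => not_congr (hQ _ _ _ fun q hq => ?_)
        have := h (q * f * (c * a⁻¹))
          (Finset.mem_union_right _ (Finset.mul_mem_mul (Finset.mul_mem_mul hq hf) hcF))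
        simpa [mul_assoc] using this
      rw [h1, h2]
    · simp [hc]

lemma owns_local (F : Finset G) (θ : ℝ) (M : ℕ) : ∃ Q : Finset G, ∀ a c : G,
    ∀ χ χ' : G → Fin M, (∀ q ∈ Q, χ (q * a) = χ' (q * a)) →
      (Owns F θ χ a c ↔ Owns F θ χ' a c) := by
  choose Q hQ using covered_local F θ M
  let Q' := (Finset.range M).biUnion Q
  have hQ' : ∀ j < M, ∀ a : G, ∀ χ χ' : G → Fin M, (∀ q ∈ Q', χ (q * a) = χ' (q * a)) →
      (a ∈ covered F θ χ j ↔ a ∈ covered F θ χ' j) := fun j hj a χ χ' h =>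
    hQ j a χ χ' fun q hq => h q (Finset.mem_biUnion.2 ⟨j, Finset.mem_range.2 hj, hq⟩)
  refine ⟨Q' ∪ F⁻¹ ∪ Q' * F * F⁻¹, fun a c χ χ' h => ?_⟩
  by_cases hc : a * c⁻¹ ∈ F
  · have hcF : c * a⁻¹ ∈ F⁻¹ := by simpa using hc
    have h1 : χ c = χ' c := by
      have := h (c * a⁻¹) (by simp only [Finset.mem_union]; tauto)
      simpa using this
    have h2 : F.filter (fun f => f * c ∉ covered F θ χ (χ c)) =
        F.filter (fun f => f * c ∉ covered F θ χ' (χ c)) := by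
      refine Finset.filter_congr fun f hf => not_congr (hQ' _ (χ c).2 _ _ _ fun q hq => ?_)
      have := h (q * f * (c * a⁻¹))
        (Finset.mem_union_right _ (Finset.mul_mem_mul (Finset.mul_mem_mul hq hf) hcF))
      simpa [mul_assoc] using this
    have h3 := hQ' _ (χ c).2 a χ χ' fun q hq => h q (by simp [hq])
    rw [Owns, Owns, IsCenter, IsCenter, h2, h3, h1]
  · simp [Owns, hc]

lemma covered_shift (k a : G) (j : ℕ) :
    a ∈ covered F θ (shift k χ) j ↔ a * k ∈ covered F θ χ j := by
  induction j generalizing a with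
  | zero => simp [covered]
  | succ j ih =>
    simp only [covered, Set.mem_union, Set.mem_ofPred_eq, ih]
    refine or_congr_right ⟨?_, ?_⟩
    · rintro ⟨c, h1, h2, h3⟩
      exact ⟨c * k, h1, by simpa using h2, by simpa [mul_assoc] using h3⟩
    · rintro ⟨c, h1, h2, h3⟩
      exact ⟨c * k⁻¹, by simpa [shift] using h1, by simpa [mul_assoc] using h2,
        by simpa [mul_assoc] using h3⟩

lemma owns_shift (k a c : G) :
    Owns F θ (shift k χ) a c ↔ Owns F θ χ (a * k) (c * k) := by
  simp only [Owns, IsCenter, covered_shift, shift, mul_assoc, mul_inv_rev, mul_inv_cancel_left]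

lemma IsProperColoring.shift (hχ : IsProperColoring F χ) (k : G) :
    IsProperColoring F (shift k χ) := fun a b hab hF =>
  hχ (a * k) (b * k) (by simpa using hab) (by simpa [mul_assoc] using hF)

/-- Greedy extension of a partial proper coloring. -/
lemma exists_properColoring_extending [Countable G] (F : Finset G) (D : Set G)
    (χ₀ : G → Fin ((F⁻¹ * F).card + 1))
    (h₀ : ∀ a ∈ D, ∀ b ∈ D, a ≠ b → b * a⁻¹ ∈ F⁻¹ * F → χ₀ a ≠ χ₀ b) :
    ∃ χ : G → Fin ((F⁻¹ * F).card + 1), IsProperColoring F χ ∧ ∀ a ∈ D, χ a = χ₀ a := by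
  obtain ⟨e, he⟩ := exists_injective_nat G
  have hsymm : ∀ a b : G, b * a⁻¹ ∈ F⁻¹ * F → a * b⁻¹ ∈ F⁻¹ * F := by
    intro a b h
    obtain ⟨x, hx, y, hy, hxy⟩ := Finset.mem_mul.1 h
    refine Finset.mem_mul.2 ⟨y⁻¹, Finset.inv_mem_inv hy, x⁻¹, by simpa using hx, ?_⟩
    rw [← mul_inv_rev, hxy]; group
  let r : G → ℕ := fun a => if a ∈ D then 0 else e a + 1
  have hfree : ∀ (a : G) (s : G → Fin ((F⁻¹ * F).card + 1)), ∃ i, ∀ x ∈ F⁻¹ * F, i ≠ s (x * a) := by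
    intro a s
    by_contra! h
    have : (Finset.univ : Finset (Fin ((F⁻¹ * F).card + 1))) ⊆
        (F⁻¹ * F).image (fun x => s (x * a)) := by
      intro i _
      obtain ⟨x, hx, rfl⟩ := h i
      exact Finset.mem_image_of_mem _ hx
    have := (Finset.card_le_card this).trans Finset.card_image_le
    simp at this
  choose pick hpick using hfree
  let wf : WellFounded (fun a b : G => r a < r b) := (measure r).wf
  let χ : G → Fin ((F⁻¹ * F).card + 1) := wf.fix fun a ih =>
    if a ∈ D then χ₀ a else pick a fun b => if h : r b < r a then ih b h else 0
  have hχ : ∀ a, χ a = if a ∈ D then χ₀ a else pick a fun b => if r b < r a then χ b else 0 := by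
    intro a
    simp only [χ]
    rw [wf.fix_eq]
    simp
  have hχD : ∀ a ∈ D, χ a = χ₀ a := fun a ha => by rw [hχ, if_pos ha]
  have key : ∀ a b, r b < r a → b * a⁻¹ ∈ F⁻¹ * F → χ a ≠ χ b := by
    intro a b hr hab
    have ha : a ∉ D := fun h => by simp [r, h] at hr
    rw [hχ a, if_neg ha]
    have := hpick a (fun b => if r b < r a then χ b else 0) _ hab
    simpa [hr] using this
  refine ⟨χ, fun a b hab hF => ?_, hχD⟩
  rcases lt_trichotomy (r a) (r b) with h | h | h
  · exact (key b a h (hsymm a b hF)).symm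
  · by_cases ha : a ∈ D <;> by_cases hb : b ∈ D
    · rw [hχD a ha, hχD b hb]
      exact h₀ a ha b hb hab hF
    · simp [r, ha, hb] at h
    · simp [r, ha, hb] at h
    · simp only [r, ha, hb, if_false, add_left_inj] at h
      exact absurd (he h) hab
  · exact key a b h hF

end Colorings

section Gluing

variable {G : Type*} [Group G]

/-- A nonempty closed shift-invariant set whose elements can be glued along an arbitrary
partition of `G`, up to the `K`-boundary of the partition. -/
structure IsFlexible (K : Finset G) (X : Set (G → Bool)) : Prop where
  nonempty : X.Nonempty
  isClosed : IsClosed X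
  shift_mem : ∀ y ∈ X, ∀ h : G, shift h y ∈ X
  glue : ∀ D : G → G → Bool, (∀ a, D a ∈ X) →
    ∃ x ∈ X, ∀ a, (∀ κ ∈ K, D (κ * a) = D a) → x a = D a a

/-- The elements of `X` which, for some proper coloring, agree with the translate of `p` on the
`K`-interior of the new part of each selected translate of `F`. -/
def tileSubshift (X : Set (G → Bool)) (K F : Finset G) (θ : ℝ) (p : G → Bool) :
    Set (G → Bool) :=
  {x | x ∈ X ∧ ∃ χ : G → Fin ((F⁻¹ * F).card + 1), IsProperColoring F χ ∧
    ∀ a c, (∀ κ ∈ K, Owns F θ χ (κ * a) c) → x a = p (a * c⁻¹)}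

lemma isClopen_of_finite_local {ι A : Type*} [TopologicalSpace A] [DiscreteTopology A]
    {P : (ι → A) → Prop} (S : Finset ι)
    (hS : ∀ χ χ' : ι → A, (∀ s ∈ S, χ s = χ' s) → (P χ ↔ P χ')) : IsClopen {χ | P χ} := by
  have key : ∀ R : (ι → A) → Prop,
      (∀ χ χ' : ι → A, (∀ s ∈ S, χ s = χ' s) → (R χ ↔ R χ')) → IsOpen {χ | R χ} := by
    intro R hR
    refine isOpen_iff_forall_mem_open.2 fun χ hχ => ?_
    refine ⟨(S : Set ι).pi fun s => {χ s}, fun χ' h => ?_,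
      isOpen_set_pi S.finite_toSet fun s _ => isOpen_discrete _, fun s _ => rfl⟩
    exact (hR χ χ' fun s hs => (h s hs).symm).1 hχ
  exact ⟨⟨key (fun χ => ¬ P χ) fun χ χ' h => not_congr (hS χ χ' h)⟩, key P hS⟩

lemma isClosed_tileSubshift {X : Set (G → Bool)} (hX : IsClosed X) (K F : Finset G) (θ : ℝ)
    (p : G → Bool) : IsClosed (tileSubshift X K F θ p) := by
  obtain ⟨Q, hQ⟩ := owns_local F θ ((F⁻¹ * F).card + 1)
  have himg : tileSubshift X K F θ p = Prod.fst ''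
      {w : (G → Bool) × (G → Fin ((F⁻¹ * F).card + 1)) | w.1 ∈ X ∧ IsProperColoring F w.2 ∧
        ∀ a c, (∀ κ ∈ K, Owns F θ w.2 (κ * a) c) → w.1 a = p (a * c⁻¹)} := by
    ext x
    simp [tileSubshift]
  rw [himg]
  refine (IsCompact.image (IsClosed.isCompact ?_) continuous_fst).isClosed
  refine (hX.preimage continuous_fst).inter (IsClosed.inter ?_ ?_)
  · refine IsClosed.preimage (f := Prod.snd) continuous_snd
      (t := {χ : G → Fin ((F⁻¹ * F).card + 1) | IsProperColoring F χ}) ?_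
    simp only [IsProperColoring, Set.ofPred_forall]
    refine isClosed_iInter fun a => isClosed_iInter fun b => isClosed_iInter fun _ =>
      isClosed_iInter fun _ => (isClopen_of_finite_local {a, b} fun χ χ' h => ?_).isClosed
    rw [h a (by simp), h b (by simp)]
  · have hforall : ∀ R : G → G → (G → Bool) × (G → Fin ((F⁻¹ * F).card + 1)) → Prop,
        (∀ a c, IsClosed {w | R a c w}) → IsClosed {w | ∀ a c, R a c w} := by
      intro R hR
      simp only [Set.ofPred_forall]
      exact isClosed_iInter fun a => isClosed_iInter fun c => hR a c
    refine hforall _ fun a c => isClosed_imp ?_ ?_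
    · refine IsOpen.preimage (f := Prod.snd) continuous_snd
        (t := {χ : G → Fin ((F⁻¹ * F).card + 1) | ∀ κ ∈ K, Owns F θ χ (κ * a) c})
        (isClopen_of_finite_local (Q * K * {a}) fun χ χ' h => ?_).isOpen
      refine forall₂_congr fun κ hκ => hQ _ _ _ _ fun q hq => h _ ?_
      rw [← mul_assoc]
      exact Finset.mul_mem_mul (Finset.mul_mem_mul hq hκ) (Finset.mem_singleton_self a)
    · exact isClosed_eq (by fun_prop) (by fun_prop)

lemma shift_mem_tileSubshift {X : Set (G → Bool)} (hX : ∀ y ∈ X, ∀ h : G, shift h y ∈ X)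
    {K F : Finset G} {θ : ℝ} {p y : G → Bool} (hy : y ∈ tileSubshift X K F θ p) (h : G) :
    shift h y ∈ tileSubshift X K F θ p := by
  obtain ⟨hyX, χ, hχ, hy⟩ := hy
  refine ⟨hX y hyX h, shift h χ, hχ.shift h, fun a c hac => ?_⟩
  have := hy (a * h) (c * h) fun κ hκ => by
    have := hac κ hκ
    rwa [owns_shift, mul_assoc] at this
  simpa [shift, mul_assoc] using this

lemma exists_glue_tiles {X : Set (G → Bool)} {K : Finset G} (hX : IsFlexible K X)
    (hK : 1 ∈ K) {F : Finset G} {θ : ℝ} {M : ℕ} {χ : G → Fin M} (hχ : IsProperColoring F χ)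
    (z D : G → G → Bool) (hz : ∀ c, z c ∈ X) (hD : ∀ a, D a ∈ X) :
    ∃ x ∈ X, (∀ a c, (∀ κ ∈ K, Owns F θ χ (κ * a) c) → x a = z c a) ∧
      ∀ a, (∀ κ ∈ K, D (κ * a) = D a ∧ ∀ c, Owns F θ χ (κ * a) c → z c = D a) →
        x a = D a a := by
  let T : G → G → Bool := fun a => if h : ∃ c, Owns F θ χ a c then z h.choose else D a
  have hT : ∀ a c, Owns F θ χ a c → T a = z c := by
    intro a c hac
    have h : ∃ c, Owns F θ χ a c := ⟨c, hac⟩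
    simp only [T, dif_pos h]
    rw [h.choose_spec.unique hχ hac]
  have hTX : ∀ a, T a ∈ X := by
    intro a
    simp only [T]
    split_ifs
    exacts [hz _, hD _]
  obtain ⟨x, hxX, hx⟩ := hX.glue T hTX
  refine ⟨x, hxX, fun a c h => ?_, fun a h => ?_⟩
  · have h1 : T a = z c := hT a c (by simpa using h 1 hK)
    rw [hx a fun κ hκ => by rw [h1, hT _ c (h κ hκ)], h1]
  · have h1 : ∀ κ ∈ K, T (κ * a) = D a := by
      intro κ hκ
      by_cases hc : ∃ c, Owns F θ χ (κ * a) c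
      · obtain ⟨c, hc⟩ := hc
        rw [hT _ c hc, (h κ hκ).2 c hc]
      · simp only [T, dif_neg hc, (h κ hκ).1]
    have h2 : T a = D a := by simpa using h1 1 hK
    rw [hx a fun κ hκ => by rw [h1 κ hκ, h2], h2]

lemma exists_isFlexible_tileSubshift [Countable G] {X : Set (G → Bool)} {K : Finset G}
    (hX : IsFlexible K X) (hK : 1 ∈ K) (F : Finset G) (θ : ℝ) {p : G → Bool} (hp : p ∈ X) :
    ∃ K' : Finset G, 1 ∈ K' ∧ IsFlexible K' (tileSubshift X K F θ p) := by
  obtain ⟨Q, hQ⟩ := owns_local F θ ((F⁻¹ * F).card + 1)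
  let E' : Finset G := insert 1 (insert 1 (F⁻¹ * F) * Q * F)
  have hpc : ∀ c : G, shift c⁻¹ p ∈ X := fun c => hX.shift_mem p hp _
  refine ⟨insert 1 (K ∪ E' * F⁻¹ * K), by simp, ?_, isClosed_tileSubshift hX.isClosed _ _ _ _,
    fun y hy h => shift_mem_tileSubshift hX.shift_mem hy h, fun D hD => ?_⟩
  · obtain ⟨χ, hχ, -⟩ := exists_properColoring_extending F ∅ (fun _ => 0) (by simp)
    obtain ⟨x, hxX, hx, -⟩ := exists_glue_tiles (θ := θ) hX hK hχ (fun c => shift c⁻¹ p)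
      (fun _ => p) hpc (fun _ => hp)
    exact ⟨x, hxX, χ, hχ, hx⟩
  · have hDX : ∀ a, D a ∈ X := fun a => (hD a).1
    have hex : ∀ z : G → Bool, ∃ ψ : G → Fin ((F⁻¹ * F).card + 1),
        z ∈ tileSubshift X K F θ p → IsProperColoring F ψ ∧
          ∀ a c, (∀ κ ∈ K, Owns F θ ψ (κ * a) c) → z a = p (a * c⁻¹) := by
      intro z
      by_cases hz : z ∈ tileSubshift X K F θ p
      · obtain ⟨ψ, hψ⟩ := hz.2
        exact ⟨ψ, fun _ => hψ⟩
      · exact ⟨fun _ => 0, fun h => absurd h hz⟩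
    choose ψ hψ using hex
    obtain ⟨χ, hχ, hχD⟩ := exists_properColoring_extending F
      {a | ∀ e ∈ F⁻¹ * F, D (e * a) = D a} (fun a => ψ (D a) a) (by
        intro a ha b _ hab hF
        have h : D b = D a := by simpa using ha _ hF
        rw [h]
        exact (hψ _ (hD a)).1 a b hab hF)
    let IsPure : G → Prop := fun c => ∀ e ∈ E', D (e * c) = D c
    obtain ⟨x, hxX, hx, hx'⟩ := exists_glue_tiles (θ := θ) hX hK hχ
      (fun c => if IsPure c then D c else shift c⁻¹ p) D (fun c => by
        split_ifs
        exacts [hDX c, hpc c]) hDX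
    refine ⟨x, ⟨hxX, χ, hχ, fun a c hac => ?_⟩, fun a ha => hx' a fun κ hκ => ⟨?_, ?_⟩⟩
    · rw [hx a c hac]
      split_ifs with hc
      · refine (hψ _ (hD c)).2 a c fun κ hκ => ?_
        have hf := (hac κ hκ).2.1
        have hloc : ∀ q ∈ Q, ∀ e ∈ insert 1 (F⁻¹ * F), D (e * (q * (κ * a))) = D c := by
          intro q hq e he
          have := hc (e * q * (κ * a * c⁻¹)) (Finset.mem_insert_of_mem
            (Finset.mul_mem_mul (Finset.mul_mem_mul he hq) hf))
          simpa [mul_assoc] using this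
        refine (hQ _ c χ _ fun q hq => ?_).1 (hac κ hκ)
        have h1 : D (q * (κ * a)) = D c := by simpa using hloc q hq 1 (by simp)
        rw [hχD _ fun e he => by rw [hloc q hq e (Finset.mem_insert_of_mem he), h1], h1]
      · rfl
    · exact ha κ (by simp [hκ])
    · intro c hc
      have hcE : ∀ e ∈ E', D (e * c) = D a := by
        intro e he
        have := ha (e * (κ * a * c⁻¹)⁻¹ * κ) (Finset.mem_insert_of_mem (Finset.mem_union_right _
          (Finset.mul_mem_mul (Finset.mul_mem_mul he (Finset.inv_mem_inv hc.2.1)) hκ)))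
        simpa [mul_assoc] using this
      have h1 : D c = D a := by simpa using hcE 1 (by simp [E'])
      have hpure : IsPure c := fun e he => by rw [hcE e he, h1]
      rw [if_pos hpure, h1]

end Gluing

section Counting

lemma card_sparse_le {ι : Type*} [Fintype ι] (M m : ℕ) {L : ℝ} (hM : 1 ≤ M) (hL : 1 ≤ L) :
    ((Finset.univ.filter fun σ : ι → Option (Fin M) =>
      (Finset.univ.filter fun s => σ s ≠ none).card ≤ m).card : ℝ) ≤
      (M * L) ^ m * (1 + 1 / L) ^ Fintype.card ι := by
  have hM' : (1 : ℝ) ≤ M := by exact_mod_cast hM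
  have hML : 1 ≤ M * L := by nlinarith
  let w : Option (Fin M) → ℝ := fun o => if o ≠ none then (M * L)⁻¹ else 1
  have hw : ∀ o, 0 ≤ w o := fun o => by
    simp only [w]
    split_ifs <;> positivity
  have hsum : ∑ o, w o = 1 + 1 / L := by
    rw [Fintype.sum_option]
    simp only [w, ne_eq, not_true_eq_false, if_false, reduceCtorEq, not_false_eq_true, if_true,
      Finset.sum_const, Finset.card_univ, Fintype.card_fin, nsmul_eq_mul]
    field_simp
  have hprod : ∀ σ : ι → Option (Fin M), ∏ s, w (σ s) =
      ((M * L)⁻¹) ^ (Finset.univ.filter fun s => σ s ≠ none).card := by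
    intro σ
    simp only [w, Finset.prod_ite, Finset.prod_const, one_pow, mul_one]
  rw [← hsum, ← Finset.card_univ, ← Finset.prod_const, Finset.prod_univ_sum,
    Fintype.piFinset_univ, Finset.mul_sum, Finset.card_eq_sum_ones, Nat.cast_sum]
  refine (Finset.sum_le_sum fun σ hσ => ?_).trans
    (Finset.sum_le_univ_sum_of_nonneg fun σ =>
      mul_nonneg (by positivity) (Finset.prod_nonneg fun s _ => hw _))
  rw [hprod, inv_pow, ← div_eq_mul_inv, Nat.cast_one, one_le_div (by positivity)]
  exact pow_le_pow_right₀ hML (Finset.mem_filter.1 hσ).2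

lemma card_le_two_pow_of_eqOn_compl {α : Type*} {W B : Finset α} (T : Finset ({a // a ∈ W} → Bool))
    (hT : ∀ v ∈ T, ∀ w ∈ T, ∀ a, a.1 ∉ B → v a = w a) : T.card ≤ 2 ^ B.card := by
  rw [← Finset.card_powerset]
  refine Finset.card_le_card_of_injOn
    (fun v => B.filter fun a => ∃ h : a ∈ W, v ⟨a, h⟩ = true)
    (fun v _ => Finset.mem_coe.2 (Finset.mem_powerset.2 (Finset.filter_subset _ _)))
    fun v hv w hw hvw => ?_
  funext a
  by_cases ha : a.1 ∈ B
  · have := congrArg (a.1 ∈ ·) hvw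
    simp only [Finset.mem_filter, ha, true_and, a.2, exists_true_left, Subtype.coe_eta,
      eq_iff_iff] at this
    exact Bool.eq_iff_iff.2 this
  · exact hT v hv w hw a ha

variable {G : Type*} [Group G] {F : Finset G} {θ : ℝ} {M : ℕ} {χ : G → Fin M}

/-- The color of a selected translate. -/
noncomputable def label (F : Finset G) (θ : ℝ) (χ : G → Fin M) (c : G) : Option (Fin M) :=
  if IsCenter F θ χ c then some (χ c) else none

lemma label_eq_some {c : G} {j : Fin M} :
    label F θ χ c = some j ↔ IsCenter F θ χ c ∧ χ c = j := by
  unfold label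
  split_ifs with h <;> simp [h]

lemma owns_iff_label {b c : G} : Owns F θ χ b c ↔ b * c⁻¹ ∈ F ∧ ∃ j, label F θ χ c = some j ∧
    ∀ c', b * c'⁻¹ ∈ F → ∀ j', label F θ χ c' = some j' → ¬ j' < j := by
  simp only [Owns, mem_covered_iff, label_eq_some]
  constructor
  · rintro ⟨h1, h2, h3⟩
    refine ⟨h2, χ c, ⟨h1, rfl⟩, ?_⟩
    rintro c' hc' _ ⟨h, rfl⟩ hlt
    exact h3 ⟨c', hlt, hc', h⟩
  · rintro ⟨h2, _, ⟨h1, rfl⟩, h3⟩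
    refine ⟨h1, h2, ?_⟩
    rintro ⟨c', hlt, hc', h⟩
    exact h3 c' hc' _ ⟨h, rfl⟩ hlt

lemma owns_congr_label {χ' : G → Fin M} {b : G}
    (h : ∀ s, b * s⁻¹ ∈ F → label F θ χ s = label F θ χ' s) (c : G) :
    Owns F θ χ b c ↔ Owns F θ χ' b c := by
  rw [owns_iff_label, owns_iff_label]
  refine and_congr_right fun hc => exists_congr fun j => ?_
  rw [h c hc]
  exact and_congr_right fun _ => forall₂_congr fun c' hc' => by rw [h c' hc']

lemma card_centers_le (hχ : IsProperColoring F χ) (S : Finset G) :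
    ((S.filter (IsCenter F θ χ)).card : ℝ) * (θ * F.card) ≤ (F * S).card := by
  let T : G → Finset G := fun c =>
    (F.filter (fun f => f * c ∉ covered F θ χ (χ c))).image (· * c)
  have hT : ∀ c, IsCenter F θ χ c → ∀ a ∈ T c, Owns F θ χ a c := by
    intro c hc a ha
    obtain ⟨f, hf, rfl⟩ := Finset.mem_image.1 ha
    rw [Finset.mem_filter] at hf
    exact ⟨hc, by simpa using hf.1, hf.2⟩
  have hsub : (S.filter (IsCenter F θ χ)).biUnion T ⊆ F * S := by
    intro a ha
    obtain ⟨c, hc, ha⟩ := Finset.mem_biUnion.1 ha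
    obtain ⟨f, hf, rfl⟩ := Finset.mem_image.1 ha
    exact Finset.mul_mem_mul (Finset.mem_filter.1 hf).1 (Finset.mem_filter.1 hc).1
  have hcard : ((S.filter (IsCenter F θ χ)).biUnion T).card =
      ∑ c ∈ S.filter (IsCenter F θ χ), (T c).card := by
    refine Finset.card_biUnion fun c hc c' hc' hne => Finset.disjoint_left.2 fun a ha ha' => ?_
    exact hne ((hT c (Finset.mem_filter.1 hc).2 a ha).unique hχ
      (hT c' (Finset.mem_filter.1 hc').2 a ha'))
  have h1 := Finset.card_le_card hsub
  rw [hcard] at h1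
  refine le_trans ?_ (Nat.cast_le.2 h1)
  rw [← nsmul_eq_mul, ← Finset.sum_const, Nat.cast_sum]
  refine Finset.sum_le_sum fun c hc => ?_
  simp only [T]
  rw [Finset.card_image_of_injective _ (mul_left_injective c)]
  exact (Finset.mem_filter.1 hc).2

lemma card_uncovered_le (hθ : 0 ≤ θ) (hF : F.Nonempty) {W S : Finset G} (hS : F⁻¹ * W ⊆ S) :
    ((W.filter (fun a => a ∉ covered F θ χ M)).card : ℝ) ≤ θ * S.card := by
  have hFpos : (0 : ℝ) < F.card := by exact_mod_cast hF.card_pos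
  set U := W.filter (fun a => a ∉ covered F θ χ M) with hU
  have hdc := Finset.sum_card_bipartiteAbove_eq_sum_card_bipartiteBelow (s := U) (t := S)
    (fun u k => u * k⁻¹ ∈ F)
  have h1 : ∀ u ∈ U, F.card ≤ (S.bipartiteAbove (fun u k => u * k⁻¹ ∈ F) u).card := by
    intro u hu
    refine Finset.card_le_card_of_injOn (fun f => f⁻¹ * u) (fun f hf => ?_) ?_
    · refine Finset.mem_coe.2 ((Finset.mem_bipartiteAbove _).2 ⟨hS (Finset.mul_mem_mul
        (Finset.inv_mem_inv hf) (Finset.mem_filter.1 hu).1), by simpa using hf⟩)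
    · intro f _ f' _ h
      simpa using h
  have h2 : ∀ k ∈ S, ((U.bipartiteBelow (fun u k => u * k⁻¹ ∈ F) k).card : ℝ) ≤
      θ * F.card := by
    intro k _
    refine le_trans (Nat.cast_le.2 ?_) (card_filter_notMem_covered_le (χ := χ) hθ k)
    refine Finset.card_le_card_of_injOn (fun u => u * k⁻¹) (fun u hu => ?_)
      (mul_left_injective _).injOn
    have hu := (Finset.mem_bipartiteBelow _).1 (Finset.mem_coe.1 hu)
    exact Finset.mem_coe.2 (Finset.mem_filter.2 ⟨hu.2, by
      simpa using (Finset.mem_filter.1 hu.1).2⟩)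
  have h3 : (U.card : ℝ) * F.card ≤ S.card * (θ * F.card) := by
    have h4 : U.card * F.card ≤
        ∑ k ∈ S, (U.bipartiteBelow (fun u k => u * k⁻¹ ∈ F) k).card := by
      rw [← hdc, ← smul_eq_mul, ← Finset.sum_const]
      exact Finset.sum_le_sum h1
    calc (U.card : ℝ) * F.card
        ≤ ∑ k ∈ S, ((U.bipartiteBelow (fun u k => u * k⁻¹ ∈ F) k).card : ℝ) := by
          exact_mod_cast h4
      _ ≤ ∑ k ∈ S, θ * F.card := Finset.sum_le_sum h2
      _ = S.card * (θ * F.card) := by rw [Finset.sum_const, nsmul_eq_mul]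
  nlinarith

/-- The elements of `W` outside the `K`-interior of the new part of every selected translate. -/
noncomputable def badSet (K F : Finset G) (θ : ℝ) (χ : G → Fin M) (W : Finset G) : Finset G :=
  W.filter fun a => ¬ ∃ c, ∀ κ ∈ K, Owns F θ χ (κ * a) c

lemma card_badSet_le {K W S : Finset G} (hK : 1 ∈ K) (hθ : 0 ≤ θ) (hF : F.Nonempty)
    (hS : F⁻¹ * K * W ⊆ S) : ((badSet K F θ χ W).card : ℝ) ≤ θ * S.card +
      (S.filter (IsCenter F θ χ)).card * ∑ κ ∈ K, ((lMul κ⁻¹ F ∆ F).card : ℝ) := by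
  have hS1 : ∀ κ ∈ K, ∀ a ∈ W, ∀ c, κ * a * c⁻¹ ∈ F → c ∈ S := by
    intro κ hκ a ha c hc
    have := hS (Finset.mul_mem_mul (Finset.mul_mem_mul (Finset.inv_mem_inv hc) hκ) ha)
    simpa [mul_assoc] using this
  have hsub : badSet K F θ χ W ⊆ W.filter (fun a => a ∉ covered F θ χ M) ∪
      (S.filter (IsCenter F θ χ)).biUnion fun c => K.biUnion fun κ =>
        (lMul κ⁻¹ F ∆ F).image (· * c) := by
    intro a ha
    obtain ⟨haW, ha⟩ := Finset.mem_filter.1 ha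
    by_cases hcov : a ∈ covered F θ χ M
    · refine Finset.mem_union_right _ ?_
      obtain ⟨c, hac⟩ := exists_owns hcov
      have hmem : ∀ c ∈ S, IsCenter F θ χ c → ∀ κ ∈ K,
          ¬ (κ * a * c⁻¹ ∈ F ↔ a * c⁻¹ ∈ F) →
          a ∈ (S.filter (IsCenter F θ χ)).biUnion fun c => K.biUnion fun κ =>
            (lMul κ⁻¹ F ∆ F).image (· * c) := by
        intro c hcS hc κ hκ h
        refine Finset.mem_biUnion.2 ⟨c, Finset.mem_filter.2 ⟨hcS, hc⟩,
          Finset.mem_biUnion.2 ⟨κ, hκ, Finset.mem_image.2 ⟨a * c⁻¹, ?_, by simp⟩⟩⟩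
        have : a * c⁻¹ ∈ lMul κ⁻¹ F ↔ κ * a * c⁻¹ ∈ F := by
          simp [lMul, mul_assoc]
        rw [Finset.mem_symmDiff, this]
        tauto
      push Not at ha
      obtain ⟨κ, hκ, hκa⟩ := ha c
      by_cases hκF : κ * a * c⁻¹ ∈ F
      · have h1 : κ * a ∈ covered F θ χ (χ c) := by
          by_contra h
          exact hκa ⟨hac.1, hκF, h⟩
        obtain ⟨c', hlt, hF', hc'⟩ := mem_covered_iff.1 h1
        refine hmem c' (hS1 κ hκ a haW c' hF') hc' κ hκ fun h => ?_
        exact hac.2.2 (mem_covered_iff.2 ⟨c', hlt, h.1 hF', hc'⟩)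
      · exact hmem c (hS1 1 hK a haW c (by simpa using hac.2.1)) hac.1 κ hκ
          fun h => hκF (h.2 hac.2.1)
    · exact Finset.mem_union_left _ (Finset.mem_filter.2 ⟨haW, hcov⟩)
  have hWS : F⁻¹ * W ⊆ S := by
    refine subset_trans ?_ hS
    gcongr
    exact fun f hf => Finset.mem_mul.2 ⟨f, hf, 1, hK, mul_one f⟩
  have h1 := (Finset.card_le_card hsub).trans (Finset.card_union_le _ _)
  have h2 : ((S.filter (IsCenter F θ χ)).biUnion fun c => K.biUnion fun κ =>
      (lMul κ⁻¹ F ∆ F).image (· * c)).card ≤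
      (S.filter (IsCenter F θ χ)).card * ∑ κ ∈ K, (lMul κ⁻¹ F ∆ F).card :=
    Finset.card_biUnion_le_card_mul _ _ _ fun c _ =>
      Finset.card_biUnion_le.trans (Finset.sum_le_sum fun κ _ => Finset.card_image_le)
  calc ((badSet K F θ χ W).card : ℝ) ≤ _ := Nat.cast_le.2 (h1.trans (Nat.add_le_add_left h2 _))
    _ ≤ _ := by
      push_cast
      gcongr
      exact card_uncovered_le hθ hF hWS

end Counting

section Entropy

variable {G : Type*} [Group G]

lemma complexity_tileSubshift_le {X : Set (G → Bool)} {K F W : Finset G} {θ : ℝ} {p : G → Bool}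
    {m B : ℕ} {L : ℝ} (hL : 1 ≤ L)
    (hm : ∀ χ : G → Fin ((F⁻¹ * F).card + 1), IsProperColoring F χ →
      ((F⁻¹ * K * W).filter (IsCenter F θ χ)).card ≤ m)
    (hB : ∀ χ : G → Fin ((F⁻¹ * F).card + 1), IsProperColoring F χ →
      (badSet K F θ χ W).card ≤ B) :
    (complexity (tileSubshift X K F θ p) W : ℝ) ≤
      (((F⁻¹ * F).card + 1 : ℕ) * L) ^ m * (1 + 1 / L) ^ (F⁻¹ * K * W).card * 2 ^ B := by
  set S := F⁻¹ * K * W with hS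
  set I := (fun (x : G → Bool) (f : {a // a ∈ W}) => x f.1) '' tileSubshift X K F θ p with hI
  have hIfin : I.Finite := Set.toFinite I
  have hch : ∀ v : {a // a ∈ W} → Bool, ∃ χ : G → Fin ((F⁻¹ * F).card + 1), v ∈ I →
      IsProperColoring F χ ∧ ∀ a : {a // a ∈ W}, ∀ c,
        (∀ κ ∈ K, Owns F θ χ (κ * a.1) c) → v a = p (a.1 * c⁻¹) := by
    intro v
    by_cases hv : v ∈ I
    · obtain ⟨x, ⟨-, χ, hχ, hx⟩, rfl⟩ := hv
      exact ⟨χ, fun _ => ⟨hχ, fun a c h => hx a.1 c h⟩⟩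
    · exact ⟨fun _ => 0, fun h => absurd h hv⟩
  choose χ hχ using hch
  let σ : ({a // a ∈ W} → Bool) → {s // s ∈ S} → Option (Fin ((F⁻¹ * F).card + 1)) :=
    fun v s => label F θ (χ v) s.1
  have hfib : ∀ b ∈ hIfin.toFinset.image σ,
      (hIfin.toFinset.filter fun v => σ v = b).card ≤ 2 ^ B := by
    intro b hb
    obtain ⟨v₀, hv₀, rfl⟩ := Finset.mem_image.1 hb
    rw [Set.Finite.mem_toFinset] at hv₀
    have hown : ∀ v, σ v = σ v₀ → ∀ a ∈ W, ∀ c, ∀ κ ∈ K,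
        (Owns F θ (χ v) (κ * a) c ↔ Owns F θ (χ v₀) (κ * a) c) := by
      intro v hv a ha c κ hκ
      refine owns_congr_label (fun s hs => ?_) c
      have hsS : s ∈ S := by
        rw [hS]
        have := Finset.mul_mem_mul (Finset.mul_mem_mul (Finset.inv_mem_inv hs) hκ) ha
        simpa [mul_assoc] using this
      exact congrFun hv ⟨s, hsS⟩
    have hval : ∀ v ∈ hIfin.toFinset.filter fun v => σ v = σ v₀, ∀ a : {a // a ∈ W}, ∀ c,
        (∀ κ ∈ K, Owns F θ (χ v₀) (κ * a.1) c) → v a = p (a.1 * c⁻¹) := by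
      intro v hv a c h
      obtain ⟨hvI, hvσ⟩ := Finset.mem_filter.1 hv
      exact (hχ v ((Set.Finite.mem_toFinset _).1 hvI)).2 a c fun κ hκ =>
        (hown v hvσ a.1 a.2 c κ hκ).2 (h κ hκ)
    refine (card_le_two_pow_of_eqOn_compl (B := badSet K F θ (χ v₀) W) _
      fun v hv w hw a ha => ?_).trans (Nat.pow_le_pow_right two_pos (hB _ (hχ v₀ hv₀).1))
    simp only [badSet, Finset.mem_filter, a.2, true_and, not_not] at ha
    obtain ⟨c, hc⟩ := ha
    rw [hval v hv a c hc, hval w hw a c hc]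
  have himg : hIfin.toFinset.image σ ⊆ Finset.univ.filter fun τ =>
      (Finset.univ.filter fun s => τ s ≠ none).card ≤ m := by
    intro τ hτ
    obtain ⟨v, hv, rfl⟩ := Finset.mem_image.1 hτ
    refine Finset.mem_filter.2 ⟨Finset.mem_univ _, le_trans ?_
      (hm _ (hχ v ((Set.Finite.mem_toFinset _).1 hv)).1)⟩
    refine Finset.card_le_card_of_injOn Subtype.val (fun s hs => ?_)
      Subtype.val_injective.injOn
    refine Finset.mem_coe.2 (Finset.mem_filter.2 ⟨s.2, ?_⟩)
    by_contra h
    simp [σ, label, h] at hs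
  have h1 : hIfin.toFinset.card ≤ 2 ^ B * (Finset.univ.filter
      fun τ : {s // s ∈ S} → Option (Fin ((F⁻¹ * F).card + 1)) =>
      (Finset.univ.filter fun s => τ s ≠ none).card ≤ m).card :=
    (Finset.card_le_mul_card_image _ _ hfib).trans
      (Nat.mul_le_mul_left _ (Finset.card_le_card himg))
  have h2 := card_sparse_le (ι := {s // s ∈ S}) ((F⁻¹ * F).card + 1) m (by omega) hL
  rw [Fintype.card_coe] at h2
  rw [complexity, ← hI, Set.ncard_eq_toFinset_card I hIfin]
  have h1' := (Nat.cast_le (α := ℝ)).2 h1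
  rw [Nat.cast_mul, Nat.cast_pow, Nat.cast_ofNat] at h1'
  rw [mul_comm] at h1'
  refine h1'.trans (mul_le_mul_of_nonneg_right ?_ (by positivity))
  refine (le_of_eq ?_).trans h2
  congr!

lemma logb_complexity_tileSubshift_le {X : Set (G → Bool)} {K F W : Finset G} {θ δ : ℝ}
    {p : G → Bool} (hK : 1 ∈ K) (hθ : 0 < θ) (hδ : 0 ≤ δ) (hF : F.Nonempty)
    (hFK : ∑ κ ∈ K, ((lMul κ⁻¹ F ∆ F).card : ℝ) ≤ δ * F.card)
    (hW : ((F * (F⁻¹ * K * W)).card : ℝ) ≤ 2 * W.card) :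
    Real.logb 2 (complexity (tileSubshift X K F θ p) W) ≤ W.card *
      (2 / (θ * F.card) * Real.logb 2 (2 * F.card ^ 3) + 4 / F.card + 2 * θ + 2 * δ / θ) := by
  have hn : (1 : ℝ) ≤ F.card := by exact_mod_cast hF.card_pos
  have hn0 : (0 : ℝ) < F.card := by linarith
  have hlog0 : 0 ≤ Real.logb 2 (2 * (F.card : ℝ) ^ 3) :=
    Real.logb_nonneg (by norm_num) (by nlinarith [one_le_pow₀ (n := 3) hn])
  have hS : ((F⁻¹ * K * W).card : ℝ) ≤ 2 * W.card :=
    le_trans (by exact_mod_cast Finset.card_le_card_mul_left hF) hW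
  have hm : ∀ χ : G → Fin ((F⁻¹ * F).card + 1), IsProperColoring F χ →
      (((F⁻¹ * K * W).filter (IsCenter F θ χ)).card : ℝ) ≤ 2 / (θ * F.card) * W.card := by
    intro χ hχ
    have := (card_centers_le (θ := θ) hχ (F⁻¹ * K * W)).trans hW
    rw [div_mul_eq_mul_div, le_div_iff₀ (by positivity)]
    exact this
  have hB : ∀ χ : G → Fin ((F⁻¹ * F).card + 1), IsProperColoring F χ →
      ((badSet K F θ χ W).card : ℝ) ≤ (2 * θ + 2 * δ / θ) * W.card := by
    intro χ hχ
    refine (card_badSet_le hK hθ.le hF subset_rfl).trans ?_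
    calc _ ≤ θ * (2 * W.card) + 2 / (θ * F.card) * W.card * (δ * F.card) := by
          gcongr
          exact hm χ hχ
      _ = _ := by field_simp
  have hcomp := complexity_tileSubshift_le (X := X) (p := p) hn
    (fun χ hχ => Nat.le_floor (hm χ hχ)) (fun χ hχ => Nat.le_floor (hB χ hχ))
  set m := ⌊2 / (θ * F.card) * W.card⌋₊ with hm_def
  set B := ⌊(2 * θ + 2 * δ / θ) * W.card⌋₊ with hB_def
  have hm' : (m : ℝ) ≤ 2 / (θ * F.card) * W.card := Nat.floor_le (by positivity)
  have hB' : (B : ℝ) ≤ (2 * θ + 2 * δ / θ) * W.card := Nat.floor_le (by positivity)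
  rcases Nat.eq_zero_or_pos (complexity (tileSubshift X K F θ p) W) with h0 | hpos
  · rw [h0, Nat.cast_zero, Real.logb_zero]
    positivity
  have hM : (((F⁻¹ * F).card + 1 : ℕ) : ℝ) * F.card ≤ 2 * F.card ^ 3 := by
    have h1 : (F⁻¹ * F).card ≤ F.card * F.card :=
      Finset.card_mul_le.trans (by rw [Finset.card_inv])
    have h2 : ((F⁻¹ * F).card : ℝ) ≤ F.card * F.card := by exact_mod_cast h1
    push_cast
    nlinarith [mul_le_mul hn hn zero_le_one hn0.le]
  have hlogL : Real.logb 2 (1 + 1 / (F.card : ℝ)) ≤ 2 / F.card := by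
    have h2 : (1 / 2 : ℝ) < Real.log 2 := by linarith [Real.log_two_gt_d9]
    rw [Real.logb, div_le_iff₀ (by linarith)]
    calc Real.log (1 + 1 / (F.card : ℝ)) ≤ 1 / F.card := by
          linarith [Real.log_le_sub_one_of_pos (show 0 < 1 + 1 / (F.card : ℝ) by positivity)]
      _ = 2 / F.card * (1 / 2) := by ring
      _ ≤ _ := by gcongr
  have hlogL0 : 0 ≤ Real.logb 2 (1 + 1 / (F.card : ℝ)) :=
    Real.logb_nonneg (by norm_num) (by rw [le_add_iff_nonneg_right]; positivity)
  calc Real.logb 2 (complexity (tileSubshift X K F θ p) W)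
      ≤ Real.logb 2 ((2 * F.card ^ 3) ^ m * (1 + 1 / (F.card : ℝ)) ^ (F⁻¹ * K * W).card *
          2 ^ B) := by
        refine Real.logb_le_logb_of_le (by norm_num) (by exact_mod_cast hpos) (hcomp.trans ?_)
        gcongr
    _ = m * Real.logb 2 (2 * F.card ^ 3) +
          (F⁻¹ * K * W).card * Real.logb 2 (1 + 1 / (F.card : ℝ)) + B := by
        rw [Real.logb_mul (by positivity) (by positivity),
          Real.logb_mul (by positivity) (by positivity), Real.logb_pow, Real.logb_pow,
          Real.logb_pow, Real.logb_self_eq_one (by norm_num), mul_one]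
    _ ≤ 2 / (θ * F.card) * W.card * Real.logb 2 (2 * F.card ^ 3) +
          2 * W.card * (2 / F.card) + (2 * θ + 2 * δ / θ) * W.card := by
        gcongr
    _ = _ := by ring

lemma IsFolnerSeq.tendsto_card [Infinite G] {F : ℕ → Finset G} (hF : IsFolnerSeq F) (N : ℕ) :
    ∀ᶠ n in atTop, N ≤ (F n).card := by
  obtain ⟨A, hA⟩ := Infinite.exists_subset_card_eq G N
  have hev : ∀ᶠ n in atTop, ∀ a ∈ A,
      (((lMul a (F n)) ∆ (F n)).card : ℝ) / ((F n).card : ℝ) < 1 / (N + 1) :=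
    (Finset.eventually_all A).2 fun a _ => (hF.2 a).eventually_lt_const (by positivity)
  filter_upwards [hev] with n hn
  by_contra! hlt
  have hpos : (0 : ℝ) < (F n).card := by exact_mod_cast (hF.1 n).card_pos
  have hinv : ∀ a ∈ A, lMul a (F n) = F n := by
    intro a ha
    have h1 := hn a ha
    rw [div_lt_iff₀ hpos] at h1
    have h2 : ((F n).card : ℝ) < N + 1 := by exact_mod_cast hlt.trans (Nat.lt_succ_self N)
    have h3 : (((lMul a (F n)) ∆ (F n)).card : ℝ) < 1 := by
      refine h1.trans ?_
      rw [one_div, inv_mul_lt_iff₀ (by positivity), mul_one]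
      exact h2
    have h4 : ((lMul a (F n)) ∆ (F n)).card = 0 := by
      have : ((lMul a (F n)) ∆ (F n)).card < 1 := by exact_mod_cast h3
      omega
    exact symmDiff_eq_bot.1 (Finset.card_eq_zero.1 h4)
  obtain ⟨f, hf⟩ := hF.1 n
  have : A.card ≤ (F n).card := Finset.card_le_card_of_injOn (· * f) (fun a ha => by
    have : a * f ∈ lMul a (F n) := Finset.mem_image_of_mem _ hf
    rwa [hinv a ha] at this) (mul_left_injective f).injOn
  omega

lemma IsFolnerSeq.eventually_sum_card_symmDiff_le {F : ℕ → Finset G} (hF : IsFolnerSeq F)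
    (K : Finset G) {δ : ℝ} (hδ : 0 < δ) :
    ∀ᶠ n in atTop, ∑ κ ∈ K, ((lMul κ⁻¹ (F n) ∆ F n).card : ℝ) ≤ δ * (F n).card := by
  have hlim : Tendsto (fun n => ∑ κ ∈ K,
      (((lMul κ⁻¹ (F n)) ∆ (F n)).card : ℝ) / ((F n).card : ℝ)) atTop (nhds (∑ κ ∈ K, 0)) :=
    tendsto_finsetSum _ fun κ _ => hF.2 κ⁻¹
  rw [Finset.sum_const_zero] at hlim
  filter_upwards [hlim.eventually_lt_const hδ] with n hn
  have hpos : (0 : ℝ) < (F n).card := by exact_mod_cast (hF.1 n).card_pos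
  rw [← Finset.sum_div, div_lt_iff₀ hpos] at hn
  exact hn.le

lemma IsFolnerSeq.eventually_card_mul_le {F : ℕ → Finset G} (hF : IsFolnerSeq F)
    (R : Finset G) : ∀ᶠ n in atTop, ((R * F n).card : ℝ) ≤ 2 * (F n).card := by
  filter_upwards [hF.eventually_sum_card_symmDiff_le R⁻¹ one_pos] with n hn
  have hsub : R * F n ⊆ F n ∪ R⁻¹.biUnion fun κ => lMul κ⁻¹ (F n) ∆ F n := by
    intro a ha
    obtain ⟨r, hr, f, hf, rfl⟩ := Finset.mem_mul.1 ha
    by_cases h : r * f ∈ F n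
    · exact Finset.mem_union_left _ h
    · refine Finset.mem_union_right _ (Finset.mem_biUnion.2 ⟨r⁻¹, Finset.inv_mem_inv hr, ?_⟩)
      exact Finset.mem_symmDiff.2 (Or.inl ⟨by simpa [lMul] using hf, h⟩)
  have h1 := (Finset.card_le_card hsub).trans ((Finset.card_union_le _ _).trans
    (Nat.add_le_add_left Finset.card_biUnion_le _))
  have h2 : ((R * F n).card : ℝ) ≤ (F n).card +
      ∑ κ ∈ R⁻¹, ((lMul κ⁻¹ (F n) ∆ F n).card : ℝ) := by exact_mod_cast h1
  linarith

lemma exists_isFlexible_subset_logb_complexity_le [Countable G] [Infinite G]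
    (hG : IsAmenable G) {X : Set (G → Bool)} {K : Finset G} (hX : IsFlexible K X) (hK : 1 ∈ K)
    {ε : ℝ} (hε : 0 < ε) :
    ∃ X' ⊆ X, ∃ K' : Finset G, 1 ∈ K' ∧ IsFlexible K' X' ∧
      ∃ W : Finset G, W.Nonempty ∧ Real.logb 2 (complexity X' W) ≤ W.card * ε := by
  obtain ⟨F, hF⟩ := hG
  set θ := ε / 8 with hθ
  have hθ0 : 0 < θ := by positivity
  have hlim : Tendsto (fun x : ℝ => 2 / (θ * x) * Real.logb 2 (2 * x ^ 3) + 4 / x) atTop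
      (nhds 0) := by
    have hlog : Tendsto (fun x : ℝ => Real.log x / x) atTop (nhds 0) :=
      Real.isLittleO_log_id_atTop.tendsto_div_nhds_zero
    have hinv (c : ℝ) : Tendsto (fun x : ℝ => c / x) atTop (nhds 0) :=
      tendsto_const_nhds.div_atTop tendsto_id
    have hsum := (((hinv (Real.log 2)).add (hlog.const_mul 3)).const_mul
      (2 / θ / Real.log 2)).add (hinv 4)
    simp only [mul_zero, add_zero] at hsum
    refine hsum.congr' ?_
    filter_upwards [eventually_gt_atTop 0] with x hx
    have h2 : Real.log 2 ≠ 0 := (Real.log_pos one_lt_two).ne'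
    rw [Real.logb, Real.log_mul two_ne_zero (by positivity), Real.log_pow]
    field_simp
    push_cast
    ring
  obtain ⟨x₀, hx₀⟩ := eventually_atTop.1 (hlim.eventually_lt_const (half_pos hε))
  obtain ⟨i, hi1, hi2⟩ := ((hF.tendsto_card ⌈x₀⌉₊).and
    (hF.eventually_sum_card_symmDiff_le K (pow_pos hθ0 2))).exists
  obtain ⟨j, hj⟩ := (hF.eventually_card_mul_le (F i * ((F i)⁻¹ * K))).exists
  obtain ⟨p, hp⟩ := hX.nonempty
  obtain ⟨K', hK', hX'⟩ := exists_isFlexible_tileSubshift hX hK (F i) θ hp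
  refine ⟨_, fun x hx => hx.1, K', hK', hX', F j, hF.1 j, ?_⟩
  refine (logb_complexity_tileSubshift_le hK hθ0 (by positivity) (hF.1 i) hi2
    (by simpa [mul_assoc] using hj)).trans ?_
  gcongr
  have h1 := hx₀ (F i).card ((Nat.le_ceil x₀).trans (by exact_mod_cast hi1))
  have h2 : 2 * θ + 2 * θ ^ 2 / θ = ε / 2 := by
    rw [hθ]
    field_simp
    ring
  linarith

end Entropy

section ZeroEntropy

variable {G : Type*} [Group G]

lemma complexity_mono {X Y : Set (G → Bool)} (h : X ⊆ Y) (W : Finset G) :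
    complexity X W ≤ complexity Y W :=
  Set.ncard_le_ncard (Set.image_mono h) (Set.toFinite _)

lemma entropyOf_eq_zero {X : Set (G → Bool)} (h : ∀ ε : ℝ, 0 < ε → ∃ W : Finset G, W.Nonempty ∧
    Real.logb 2 (complexity X W) ≤ W.card * ε) : entropyOf X = 0 := by
  have hnonneg : ∀ r ∈ {r : ℝ | ∃ F : Finset G, F.Nonempty ∧
      r = Real.logb 2 (complexity X F) / (F.card : ℝ)}, 0 ≤ r := by
    rintro r ⟨F, -, rfl⟩
    refine div_nonneg ?_ (Nat.cast_nonneg _)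
    exact div_nonneg (Real.log_natCast_nonneg _) (Real.log_nonneg one_le_two)
  refine le_antisymm (le_of_forall_pos_le_add fun ε hε => ?_) (Real.sInf_nonneg hnonneg)
  obtain ⟨W, hW, hle⟩ := h ε hε
  have hpos : (0 : ℝ) < W.card := by exact_mod_cast hW.card_pos
  rw [zero_add]
  refine (csInf_le ⟨0, hnonneg⟩ ⟨W, hW, rfl⟩).trans ?_
  rwa [div_le_iff₀ hpos, mul_comm]

lemma exists_subset_entropyOf_eq_zero [Countable G] [Infinite G] (hG : IsAmenable G)
    {X : Set (G → Bool)} {K : Finset G} (hX : IsFlexible K X) (hK : 1 ∈ K) :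
    ∃ Y ⊆ X, Y.Nonempty ∧ IsClosed Y ∧ (∀ y ∈ Y, ∀ h : G, shift h y ∈ Y) ∧ entropyOf Y = 0 := by
  let P := {q : Set (G → Bool) × Finset G // 1 ∈ q.2 ∧ IsFlexible q.2 q.1}
  have hstep : ∀ (n : ℕ) (q : P), ∃ q' : P, q'.1.1 ⊆ q.1.1 ∧
      ∃ W : Finset G, W.Nonempty ∧
        Real.logb 2 (complexity q'.1.1 W) ≤ W.card * (1 / (n + 1 : ℝ)) := by
    intro n q
    obtain ⟨X', hsub, K', hK', hX', hW⟩ :=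
      exists_isFlexible_subset_logb_complexity_le hG q.2.2 q.2.1 (ε := 1 / (n + 1 : ℝ)) (by positivity)
    exact ⟨⟨(X', K'), hK', hX'⟩, hsub, hW⟩
  choose next hnext hW using hstep
  let Q : ℕ → P := fun n => Nat.rec ⟨(X, K), hK, hX⟩ next n
  refine ⟨⋂ n, (Q n).1.1, Set.iInter_subset _ 0, ?_, ?_, ?_, ?_⟩
  · exact IsCompact.nonempty_iInter_of_sequence_nonempty_isCompact_isClosed _
      (fun n => hnext n (Q n)) (fun n => (Q n).2.2.nonempty) hX.isClosed.isCompact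
      fun n => (Q n).2.2.isClosed
  · exact isClosed_iInter fun n => (Q n).2.2.isClosed
  · exact fun y hy h => Set.mem_iInter.2 fun n =>
      (Q n).2.2.shift_mem y (Set.mem_iInter.1 hy n) h
  · refine entropyOf_eq_zero fun ε hε => ?_
    obtain ⟨n, hn⟩ := exists_nat_one_div_lt hε
    obtain ⟨W, hWne, hle⟩ := hW n (Q n)
    refine ⟨W, hWne, ?_⟩
    rcases Nat.eq_zero_or_pos (complexity (⋂ n, (Q n).1.1) W) with h0 | hpos
    · rw [h0, Nat.cast_zero, Real.logb_zero]
      positivity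
    · calc Real.logb 2 (complexity (⋂ n, (Q n).1.1) W)
          ≤ Real.logb 2 (complexity (next n (Q n)).1.1 W) := by
            refine Real.logb_le_logb_of_le one_lt_two (by exact_mod_cast hpos) ?_
            exact_mod_cast complexity_mono (Set.iInter_subset (fun n => (Q n).1.1) (n + 1)) W
        _ ≤ W.card * (1 / (n + 1 : ℝ)) := hle
        _ ≤ W.card * ε := by gcongr

/-- A choice of representatives for the right cosets of a subgroup. -/
lemma exists_rightCoset_representative (H : Subgroup G) :
    ∃ r : G → G, (∀ a, r a * a⁻¹ ∈ H) ∧ ∀ h ∈ H, ∀ a, r (h * a) = r a := by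
  refine ⟨fun a => (Quotient.mk (QuotientGroup.rightRel H) a).out, fun a => ?_,
    fun h hh a => congrArg Quotient.out (Quotient.sound (s := QuotientGroup.rightRel H) ?_)⟩
  · have : (QuotientGroup.rightRel H) a _ :=
      Setoid.symm' _ (Quotient.mk_out (s := QuotientGroup.rightRel H) a)
    exact QuotientGroup.rightRel_apply.1 this
  · refine QuotientGroup.rightRel_apply.2 ?_
    simpa using H.inv_mem hh

lemma exists_antiperiodic_zero_entropy {g : G} (hg : ¬ IsOfFinOrder g) :
    ∃ X : Set (G → Bool), X.Nonempty ∧ IsClosed X ∧ (∀ y ∈ X, ∀ h : G, shift h y ∈ X) ∧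
      entropyOf X = 0 ∧ ∀ y ∈ X, shift g y ≠ y := by
  refine ⟨{x | ∀ h, x (g * h) = !x h}, ?_, ?_, ?_, ?_, ?_⟩
  · obtain ⟨r, hr, hrH⟩ := exists_rightCoset_representative (Subgroup.zpowers g)
    choose i hi using fun a => Subgroup.mem_zpowers_iff.1 (hr a)
    refine ⟨fun a => decide (Even (i a)), fun a => ?_⟩
    have : i a = i (g * a) + 1 := by
      refine injective_zpow_iff_not_isOfFinOrder.2 hg ?_
      simp only
      rw [hi a, zpow_add_one, hi (g * a), hrH g (Subgroup.mem_zpowers g)]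
      group
    simp [this, ← Int.not_even_iff_odd]
  · simp only [Set.ofPred_forall]
    exact isClosed_iInter fun h => isClosed_eq (by fun_prop)
      ((continuous_of_discreteTopology (f := Bool.not)).comp (continuous_apply h))
  · intro y hy h a
    simpa [shift, mul_assoc] using hy (a * h)
  · refine entropyOf_eq_zero fun ε hε => ?_
    obtain ⟨n, hn⟩ := exists_nat_one_div_lt hε
    set W := (Finset.range (n + 1)).image fun i : ℕ => g ^ i with hWdef
    have hcard : W.card = n + 1 := by
      rw [hWdef, Finset.card_image_of_injective _ (injective_pow_iff_not_isOfFinOrder.2 hg),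
        Finset.card_range]
    have h1W : 1 ∈ W := Finset.mem_image.2 ⟨0, by simp, pow_zero g⟩
    refine ⟨W, ⟨1, h1W⟩, ?_⟩
    have hcomp : complexity {x : G → Bool | ∀ h, x (g * h) = !x h} W ≤ 2 := by
      rw [complexity, ← Fintype.card_bool, ← Nat.card_eq_fintype_card, ← Set.ncard_univ]
      refine Set.ncard_le_ncard_of_injOn (fun v => v ⟨1, h1W⟩) (fun _ _ => Set.mem_univ _) ?_
        Set.finite_univ
      rintro _ ⟨x, hx, rfl⟩ _ ⟨y, hy, rfl⟩ hxy
      have hpow : ∀ i : ℕ, x (g ^ i) = y (g ^ i) := by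
        intro i
        induction i with
        | zero => simpa using hxy
        | succ i ih => rw [pow_succ', hx, hy, ih]
      funext ⟨a, ha⟩
      obtain ⟨i, -, rfl⟩ := Finset.mem_image.1 ha
      exact hpow i
    have hle : Real.logb 2 (complexity {x : G → Bool | ∀ h, x (g * h) = !x h} W) ≤ 1 := by
      rcases Nat.eq_zero_or_pos (complexity {x : G → Bool | ∀ h, x (g * h) = !x h} W) with h0 | hpos
      · rw [h0, Nat.cast_zero, Real.logb_zero]
        exact zero_le_one
      · rw [← Real.logb_self_eq_one (b := 2) one_lt_two]
        exact Real.logb_le_logb_of_le one_lt_two (by exact_mod_cast hpos) (by exact_mod_cast hcomp)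
    refine hle.trans ?_
    rw [hcard]
    rw [div_lt_iff₀ (by positivity)] at hn
    push_cast
    linarith
  · intro y hy h
    have h1 := hy 1
    have h2 := congrFun h 1
    simp only [shift, one_mul] at h2
    rw [mul_one, h2] at h1
    simp at h1

/-- The set of configurations that are nonconstant on every right coset of a nontrivial finite
subgroup is flexible. -/
lemma isFlexible_nonconstant {H : Subgroup G} {K : Finset G} (hK : (K : Set G) = H)
    (hH : H ≠ ⊥) : IsFlexible K {x : G → Bool | ∀ a, ∃ h ∈ K, x (h * a) ≠ x a} := by
  have hmem : ∀ h, h ∈ K ↔ h ∈ H := fun h => by rw [← Finset.mem_coe, hK, SetLike.mem_coe]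
  obtain ⟨r, hr, hrH⟩ := exists_rightCoset_representative H
  refine ⟨?_, ?_, ?_, ?_⟩
  · obtain ⟨⟨k, hk⟩, hk1⟩ := H.ne_bot_iff_exists_ne_one.1 hH
    refine ⟨fun a => decide (r a = a), fun a => ?_⟩
    by_cases ha : r a = a
    · refine ⟨k, (hmem k).2 hk, ?_⟩
      have hne : a ≠ k * a := fun h => hk1 (Subtype.ext (mul_eq_right.1 h.symm))
      simp [hrH k hk, ha, hne]
    · refine ⟨r a * a⁻¹, (hmem _).2 (hr a), ?_⟩
      have : r (r a) = r a := by simpa using hrH _ (hr a) a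
      simp [this, ha]
  · simp only [Set.ofPred_forall]
    refine isClosed_iInter fun a =>
      (isClopen_of_finite_local (K * {a} ∪ {a}) fun x y h => ?_).isClosed
    refine exists_congr fun k => and_congr_right fun hk => ?_
    rw [h a (by simp), h (k * a) (Finset.mem_union_left _
      (Finset.mul_mem_mul hk (Finset.mem_singleton_self a)))]
  · intro y hy h a
    simpa [shift, mul_assoc] using hy (a * h)
  · intro D hD
    refine ⟨fun a => D (r a) a, fun a => ?_, fun a ha => ?_⟩
    · obtain ⟨h, hh, hne⟩ := hD (r a) a
      exact ⟨h, hh, by simpa only [hrH h ((hmem h).1 hh)] using hne⟩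
    · have := ha (r a * a⁻¹) ((hmem _).2 (hr a))
      rw [inv_mul_cancel_right] at this
      simp only [this]

lemma shift_ne_of_nonconstant {g : G} {K : Finset G} (hK : (K : Set G) = Subgroup.zpowers g)
    {y : G → Bool} (hy : ∃ h ∈ K, y (h * 1) ≠ y 1) : shift g y ≠ y := by
  intro hfix
  obtain ⟨h, hh, hne⟩ := hy
  have hper : ∀ a, y (a * g) = y a := congrFun hfix
  have hpow : ∀ i : ℤ, y (g ^ i) = y 1 := by
    intro i
    induction i with
    | zero => rw [zpow_zero]
    | succ i ih => rw [zpow_add_one, hper, ih]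
    | pred i ih => rw [← hper, ← zpow_add_one, sub_add_cancel, ih]
  obtain ⟨i, rfl⟩ : h ∈ Subgroup.zpowers g := by
    rwa [← SetLike.mem_coe, ← hK, Finset.mem_coe]
  exact hne (by rw [mul_one]; exact hpow i)

end ZeroEntropy

/-- for every `g ≠ 1` in an infinite countable amenable group there is a
two-element alphabet `Λ` and a nonempty closed shift-invariant subset of `Λ^G` with
topological entropy zero on which the shift by `g` has no fixed points. -/
theorem statement18 {G : Type*} [Group G] [Countable G] [Infinite G] (hG : IsAmenable G)
    (g : G) (hg : g ≠ 1) :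
    ∃ (Λ : Type) (_ : Fintype Λ), Fintype.card Λ = 2 ∧
      ∃ X : Set (G → Λ), X.Nonempty ∧
        (@IsClosed (G → Λ) (@Pi.topologicalSpace G (fun _ => Λ) (fun _ => ⊥)) X) ∧
        (∀ y ∈ X, ∀ h : G, shift h y ∈ X) ∧
        entropyOf X = 0 ∧
        (∀ y ∈ X, shift g y ≠ y) := by
  suffices h : ∃ X : Set (G → Bool), X.Nonempty ∧ IsClosed X ∧
      (∀ y ∈ X, ∀ h : G, shift h y ∈ X) ∧ entropyOf X = 0 ∧ ∀ y ∈ X, shift g y ≠ y from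
    ⟨Bool, inferInstance, Fintype.card_bool, h⟩
  by_cases hfin : IsOfFinOrder g
  · have hfinite : (Subgroup.zpowers g : Set G).Finite := finite_zpowers.2 hfin
    have hflex : IsFlexible hfinite.toFinset _ :=
      isFlexible_nonconstant hfinite.coe_toFinset (Subgroup.zpowers_ne_bot.2 hg)
    obtain ⟨Y, hYX, hne, hcl, hinv, hent⟩ := exists_subset_entropyOf_eq_zero hG hflex
      (hfinite.mem_toFinset.2 (Subgroup.one_mem _))
    exact ⟨Y, hne, hcl, hinv, hent, fun y hy =>
      shift_ne_of_nonconstant hfinite.coe_toFinset (hYX hy 1)⟩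
  · exact exists_antiperiodic_zero_entropy hfin

end AmenableTilings
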